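/- arXiv:2511.20019 — 2 statements merged into one kernel-verified Lean document; each statement's English description precedes it below -/
import Mathlib

section
/- Let G be a finite simple graph on a finite vertex set V whose complement graph contains no triangle (equivalently, G contains no independent set of three vertices). Then G is e-positive; that is, the chromatic symmetric function X_G can be written as a linear combination, with nonnegative rational coefficients, of the elementary symmetric functions e_λ over all partitions λ of |V|. -/
open scoped Classical

/-- The chromatic symmetric function of a finite simple graph `G`, as a formal power
series over `ℚ` in variables indexed by the positive integers: the coefficient of the
monomial `∏ i, x_i ^ d i` is the number of proper colorings `κ : V → ℕ+` whose color
classes have the sizes prescribed by `d`. -/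
noncomputable def chromaticSymmetricFunction {V : Type} [Fintype V] (G : SimpleGraph V) :
    MvPowerSeries ℕ+ ℚ :=
  fun d => (Nat.card {κ : V → ℕ+ // (∀ u v, G.Adj u v → κ u ≠ κ v) ∧
    ∀ i : ℕ+, Nat.card {v : V // κ v = i} = d i} : ℚ)

/-- The elementary symmetric function `e_m = ∑_{i₁ < ⋯ < i_m} x_{i₁} ⋯ x_{i_m}`:
its coefficient at a monomial `d` is `1` iff `d` is squarefree with exactly `m` variables. -/
noncomputable def elementarySymmetric (m : ℕ) : MvPowerSeries ℕ+ ℚ :=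
  fun d => if (∀ i, d i ≤ 1) ∧ d.support.card = m then (1 : ℚ) else 0

/-- For a partition `λ = (λ₁, …, λ_k)`, the function `e_λ = e_{λ₁} ⋯ e_{λ_k}`. -/
noncomputable def elementarySymmetricPartition {n : ℕ} (lam : n.Partition) :
    MvPowerSeries ℕ+ ℚ :=
  (lam.parts.map elementarySymmetric).prod

/-- A graph `G` is `e`-positive if `X_G` is a nonnegative rational linear combination of
the `e_λ` over partitions `λ` of the number of vertices. -/
def EPositive {V : Type} [Fintype V] (G : SimpleGraph V) : Prop :=
  ∃ c : (Fintype.card V).Partition → ℚ,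
    (∀ lam, 0 ≤ c lam) ∧
    chromaticSymmetricFunction G =
      ∑ lam : (Fintype.card V).Partition, c lam • elementarySymmetricPartition lam

open MvPolynomial in
/-- `p = ∑ X_v`. -/
noncomputable def pPoly (V : Type) [Fintype V] : MvPolynomial V ℚ := ∑ v : V, X v

/-- `q = ∑ X_u X_v` over the edges of `H`. -/
noncomputable def qPoly {V : Type} [Fintype V] (H : SimpleGraph V) : MvPolynomial V ℚ :=
  ∑ v : V, ∑ u : V, if H.Adj u v then MvPolynomial.C (1/2) * (MvPolynomial.X u * MvPolynomial.X v) else 0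

/-- Complete homogeneous (second kind) recursion. -/
def uSeq {R : Type} [CommRing R] (p q : R) : ℕ → R
  | 0 => 1
  | 1 => p
  | m + 2 => p * uSeq p q (m + 1) - q * uSeq p q m

/-- Power sum recursion. -/
def pSeq {R : Type} [CommRing R] (p q : R) : ℕ → R
  | 0 => 2
  | 1 => p
  | m + 2 => p * pSeq p q (m + 1) - q * pSeq p q m

theorem pSeq_eq {R : Type} [CommRing R] (p q : R) (m : ℕ) :
    pSeq p q (m + 2) = p * uSeq p q (m + 1) - 2 * q * uSeq p q m := by
  induction m using Nat.twoStepInduction with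
  | zero => simp [pSeq, uSeq]; ring
  | one => simp [pSeq, uSeq]; ring
  | more m h1 h2 =>
    rw [pSeq, h2, h1]; simp only [uSeq]; ring

/-- The symmetric element `α^i β^j + α^j β^i`. -/
def sSeq {R : Type} [CommRing R] (p q : R) (i j : ℕ) : R :=
  q ^ (min i j) * pSeq p q (max i j - min i j)

theorem sSeq_comm {R : Type} [CommRing R] (p q : R) (i j : ℕ) : sSeq p q i j = sSeq p q j i := by
  simp [sSeq, min_comm, max_comm]

theorem sSeq_mul_le {R : Type} [CommRing R] (p q : R) (i j : ℕ) (h : j ≤ i) :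
    p * sSeq p q i j = sSeq p q (i + 1) j + sSeq p q i (j + 1) := by
  obtain ⟨m, rfl⟩ := Nat.exists_eq_add_of_le h
  rcases m with _ | m
  · simp [sSeq, pSeq]; ring
  · have h1 : max (j + (m+1)) j - min (j + (m+1)) j = m + 1 := by omega
    have h2 : max (j + (m+1) + 1) j - min (j + (m+1) + 1) j = m + 2 := by omega
    have h3 : max (j + (m+1)) (j+1) - min (j + (m+1)) (j+1) = m := by omega
    have h4 : min (j + (m+1)) j = j := by omega
    have h5 : min (j + (m+1) + 1) j = j := by omega
    have h6 : min (j + (m+1)) (j+1) = j + 1 := by omega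
    unfold sSeq
    rw [h1, h2, h3, h4, h5, h6, pSeq]; ring

theorem sSeq_mul {R : Type} [CommRing R] (p q : R) (i j : ℕ) :
    p * sSeq p q i j = sSeq p q (i + 1) j + sSeq p q i (j + 1) := by
  rcases le_total j i with h | h
  · exact sSeq_mul_le p q i j h
  · rw [sSeq_comm, sSeq_mul_le p q j i h, sSeq_comm p q (j+1), sSeq_comm p q j, add_comm]

/-- The binomial expansion, summed over subsets. -/
theorem pow_mul_sSeq {R ι : Type} [CommRing R] (p q : R) (O : Finset ι) :
    ∀ i j, p ^ O.card * sSeq p q i j =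
      ∑ A ∈ O.powerset, sSeq p q (i + A.card) (j + (O.card - A.card)) := by
  induction O using Finset.induction_on with
  | empty => simp
  | insert a s ha ih =>
    intro i j
    rw [Finset.sum_powerset_insert ha, Finset.card_insert_of_notMem ha, pow_succ, mul_assoc, sSeq_mul,
      mul_add, ih, ih, add_comm]
    congr 1
    · refine Finset.sum_congr rfl fun A hA => ?_
      have := Finset.card_le_card (Finset.mem_powerset.1 hA)
      congr 1; omega
    · refine Finset.sum_congr rfl fun A hA => ?_
      have hA := Finset.mem_powerset.1 hA
      have := Finset.card_le_card hA
      rw [Finset.card_insert_of_notMem (fun h => ha (hA h))]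
      congr 1 <;> omega

/-- Coefficientwise nonnegativity. -/
def CPos {V : Type} (f : MvPolynomial V ℚ) : Prop := ∀ d, 0 ≤ f.coeff d

namespace CPos
variable {V : Type} {f g : MvPolynomial V ℚ}

theorem add (hf : CPos f) (hg : CPos g) : CPos (f + g) := fun d => by
  rw [MvPolynomial.coeff_add]; exact add_nonneg (hf d) (hg d)

theorem zero : CPos (0 : MvPolynomial V ℚ) := fun d => by simp

theorem one : CPos (1 : MvPolynomial V ℚ) := fun d => by
  rw [MvPolynomial.coeff_one]; split_ifs <;> simp

theorem X (v : V) : CPos (MvPolynomial.X v : MvPolynomial V ℚ) := fun d => by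
  rw [MvPolynomial.coeff_X]; split_ifs <;> simp

theorem C {c : ℚ} (hc : 0 ≤ c) : CPos (MvPolynomial.C c : MvPolynomial V ℚ) := fun d => by
  rw [MvPolynomial.coeff_C]; split_ifs <;> simp [hc]

theorem mul (hf : CPos f) (hg : CPos g) : CPos (f * g) := fun d => by
  rw [MvPolynomial.coeff_mul]
  exact Finset.sum_nonneg fun x _ => mul_nonneg (hf _) (hg _)

theorem pow (hf : CPos f) (n : ℕ) : CPos (f ^ n) := by
  induction n with
  | zero => simpa using one
  | succ n ih => rw [pow_succ]; exact ih.mul hf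

theorem sum {ι : Type} (s : Finset ι) (F : ι → MvPolynomial V ℚ) (h : ∀ i ∈ s, CPos (F i)) :
    CPos (∑ i ∈ s, F i) := fun d => by
  rw [MvPolynomial.coeff_sum]
  exact Finset.sum_nonneg fun i hi => h i hi d

end CPos

section main
variable {V : Type} [Fintype V] (H : SimpleGraph V)

theorem qPoly_pos : CPos (qPoly H) := by
  refine CPos.sum _ _ fun v _ => CPos.sum _ _ fun u _ => ?_
  split_ifs
  · exact (CPos.C (by norm_num)).mul ((CPos.X u).mul (CPos.X v))
  · exact CPos.zero

/-- Any way of choosing one orientation of each edge gives `q`. -/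
theorem qPoly_eq (ch : V → V → Prop) (hch : ∀ u v, H.Adj u v → (ch u v ↔ ¬ ch v u))  :
    qPoly H = ∑ v : V, ∑ u : V, if H.Adj u v ∧ ch u v then
      (MvPolynomial.X u * MvPolynomial.X v : MvPolynomial V ℚ) else 0 := by
  set T := ∑ v : V, ∑ u : V, if H.Adj u v ∧ ch u v then
      (MvPolynomial.X u * MvPolynomial.X v : MvPolynomial V ℚ) else 0 with hT
  have hT' : T = ∑ v : V, ∑ u : V, if H.Adj u v ∧ ch v u then
      (MvPolynomial.X u * MvPolynomial.X v : MvPolynomial V ℚ) else 0 := by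
    rw [hT, Finset.sum_comm]
    refine Finset.sum_congr rfl fun v _ => Finset.sum_congr rfl fun u _ => ?_
    rw [H.adj_comm, mul_comm]
  have h2 : T + T = ∑ v : V, ∑ u : V, if H.Adj u v then
      (MvPolynomial.X u * MvPolynomial.X v : MvPolynomial V ℚ) else 0 := by
    nth_rewrite 2 [hT']
    rw [hT, ← Finset.sum_add_distrib]
    refine Finset.sum_congr rfl fun v _ => ?_
    rw [← Finset.sum_add_distrib]
    refine Finset.sum_congr rfl fun u _ => ?_
    by_cases h : H.Adj u v
    · have := hch u v h
      by_cases h' : ch v u <;> simp_all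
    · simp [h]
  have h3 : qPoly H = MvPolynomial.C (1/2) * (T + T) := by
    rw [h2, qPoly, Finset.mul_sum]
    refine Finset.sum_congr rfl fun v _ => ?_
    rw [Finset.mul_sum]
    refine Finset.sum_congr rfl fun u _ => ?_
    split_ifs <;> simp
  rw [h3, ← two_mul, ← mul_assoc]
  have : (2 : MvPolynomial V ℚ) = MvPolynomial.C 2 := (map_ofNat MvPolynomial.C 2).symm
  rw [this, ← MvPolynomial.C_mul]; norm_num

theorem two_qPoly : 2 * qPoly H = ∑ v : V, MvPolynomial.X v *
    ∑ u ∈ Finset.univ.filter (fun u => H.Adj u v), (MvPolynomial.X u : MvPolynomial V ℚ) := by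
  rw [qPoly, Finset.mul_sum]
  refine Finset.sum_congr rfl fun v _ => ?_
  rw [Finset.mul_sum, Finset.mul_sum, Finset.sum_filter]
  refine Finset.sum_congr rfl fun u _ => ?_
  split_ifs
  · rw [← mul_assoc]
    have : (2 : MvPolynomial V ℚ) = MvPolynomial.C 2 := (map_ofNat MvPolynomial.C 2).symm
    rw [this, ← MvPolynomial.C_mul, mul_comm (MvPolynomial.X v)]; norm_num
  · simp

theorem key_pos (hH : H.CliqueFree 3) (m : ℕ) : ∀ K : Finset V,
    (∀ u ∈ K, ∀ v ∈ K, ¬ H.Adj u v) →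
    CPos (uSeq (pPoly V) (qPoly H) (m + 1) -
      (∑ u ∈ K, MvPolynomial.X u) * uSeq (pPoly V) (qPoly H) m) := by
  have hsplit : ∀ K : Finset V, pPoly V - ∑ u ∈ K, MvPolynomial.X u = ∑ v ∈ Kᶜ, MvPolynomial.X v := by
    intro K
    rw [pPoly, ← Finset.sum_add_sum_compl K]; ring
  induction m with
  | zero =>
    intro K _
    simp only [uSeq, mul_one]
    rw [hsplit]
    exact CPos.sum _ _ fun v _ => CPos.X v
  | succ m ih =>
    intro K hK
    let r := Fintype.equivFin V
    let KK : V → Finset V := fun v => Finset.univ.filter (fun u => H.Adj u v ∧ (u ∈ K ∨ r u < r v))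
    have hq : qPoly H = ∑ v ∈ Kᶜ, MvPolynomial.X v * ∑ u ∈ KK v, MvPolynomial.X u := by
      rw [qPoly_eq H (fun u v => v ∉ K ∧ (u ∈ K ∨ r u < r v))]
      · rw [← Finset.sum_add_sum_compl K, Finset.sum_eq_zero, zero_add]
        · refine Finset.sum_congr rfl fun v hv => ?_
          rw [Finset.mul_sum, Finset.sum_filter]
          refine Finset.sum_congr rfl fun u _ => ?_
          have : v ∉ K := by simpa using hv
          simp [this, mul_comm]
        · intro v hv
          refine Finset.sum_eq_zero fun u _ => ?_
          simp [hv]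
      · intro u v huv
        have h1 := hK u
        have h2 : r u ≠ r v := fun h => huv.ne (r.injective h)
        by_cases hu : u ∈ K <;> by_cases hv : v ∈ K
        · exact absurd huv (h1 hu v hv)
        · simp [hu, hv]
        · simp [hu, hv]
        · simp only [hu, hv]; simp; omega
    have : uSeq (pPoly V) (qPoly H) (m + 1 + 1) -
      (∑ u ∈ K, MvPolynomial.X u) * uSeq (pPoly V) (qPoly H) (m + 1) =
      ∑ v ∈ Kᶜ, MvPolynomial.X v * (uSeq (pPoly V) (qPoly H) (m + 1) -
        (∑ u ∈ KK v, MvPolynomial.X u) * uSeq (pPoly V) (qPoly H) m) := by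
      simp only [mul_sub, Finset.sum_sub_distrib, ← mul_assoc, ← Finset.sum_mul]
      rw [← hq, ← hsplit, uSeq]; ring
    rw [this]
    refine CPos.sum _ _ fun v _ => (CPos.X v).mul (ih _ ?_)
    intro a ha b hb hab
    simp only [KK, Finset.mem_filter] at ha hb
    exact hH {a, b, v} (SimpleGraph.is3Clique_triple_iff.2 ⟨hab, ha.2.1, hb.2.1⟩)

theorem pSeq_pos (hH : H.CliqueFree 3) (m : ℕ) : CPos (pSeq (pPoly V) (qPoly H) m) := by
  rcases m with _ | _ | m
  · have : (2 : MvPolynomial V ℚ) = MvPolynomial.C 2 := (map_ofNat MvPolynomial.C 2).symm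
    rw [pSeq, this]; exact CPos.C (by norm_num)
  · exact CPos.sum _ _ fun v _ => CPos.X v
  · have : pSeq (pPoly V) (qPoly H) (m + 2) = ∑ v : V, MvPolynomial.X v * (uSeq (pPoly V) (qPoly H) (m + 1) -
        (∑ u ∈ Finset.univ.filter (fun u => H.Adj u v), MvPolynomial.X u) * uSeq (pPoly V) (qPoly H) m) := by
      simp only [mul_sub, Finset.sum_sub_distrib, ← mul_assoc, ← Finset.sum_mul]
      rw [← two_qPoly, pSeq_eq, pPoly]
    rw [this]
    refine CPos.sum _ _ fun v _ => (CPos.X v).mul (key_pos H hH m _ ?_)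
    intro a ha b hb hab
    simp only [Finset.mem_filter] at ha hb
    exact hH {a, b, v} (SimpleGraph.is3Clique_triple_iff.2 ⟨hab, ha.2, hb.2⟩)

theorem sSeq_pos (hH : H.CliqueFree 3) (i j : ℕ) : CPos (sSeq (pPoly V) (qPoly H) i j) :=
  ((qPoly_pos H).pow _).mul (pSeq_pos H hH _)

end main

section count
variable {V : Type} [Fintype V] (G : SimpleGraph V)

/-- Independent sets of size `r`. -/
noncomputable def indepSets (r : ℕ) : Finset (Finset V) :=
  Finset.univ.filter (fun I => I.card = r ∧ ∀ u ∈ I, ∀ v ∈ I, ¬ G.Adj u v)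

/-- Generating polynomial of independent sets of size `r`. -/
noncomputable def lPoly (r : ℕ) : MvPolynomial V ℚ :=
  ∑ I ∈ indepSets G r, ∏ v ∈ I, MvPolynomial.X v

theorem lPoly_one : lPoly G 1 = pPoly V := by
  rw [lPoly, pPoly]
  symm
  refine Finset.sum_bij (fun v _ => {v}) ?_ ?_ ?_ ?_
  · intro v _; simp [indepSets]
  · intro a _ b _ h; simpa using h
  · intro I hI
    simp only [indepSets, Finset.mem_filter] at hI
    obtain ⟨v, rfl⟩ := Finset.card_eq_one.1 hI.2.1
    exact ⟨v, by simp, rfl⟩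
  · intro v _; simp

theorem lPoly_two : lPoly G 2 = qPoly Gᶜ := by
  let r := Fintype.equivFin V
  rw [qPoly_eq Gᶜ (fun u v => r u < r v)]
  · rw [← Finset.sum_product', lPoly]
    symm
    trans ∑ x ∈ (Finset.univ ×ˢ Finset.univ).filter
      (fun x : V × V => Gᶜ.Adj x.2 x.1 ∧ r x.2 < r x.1),
        (MvPolynomial.X x.2 * MvPolynomial.X x.1 : MvPolynomial V ℚ)
    · rw [Finset.sum_filter]
      refine Finset.sum_congr rfl fun x _ => ?_
      congr
    refine Finset.sum_bij (fun x _ => {x.1, x.2}) ?_ ?_ ?_ ?_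
    · rintro ⟨v, u⟩ h
      simp only [Finset.mem_filter, SimpleGraph.compl_adj] at h
      have h1 := h.2.1.2
      have h2 : ¬ G.Adj v u := fun h => h1 h.symm
      simp [indepSets, Finset.card_pair h.2.1.1.symm, h1, h2]
    · rintro ⟨a, b⟩ h ⟨c, d⟩ h' he
      simp only [Finset.mem_filter] at h h'
      have h1 := h.2.2
      have h2 := h'.2.2
      have ha : a ∈ ({c, d} : Finset V) := by simp only at he; rw [← he]; simp
      have hb : b ∈ ({c, d} : Finset V) := by simp only at he; rw [← he]; simp
      simp only [Finset.mem_insert, Finset.mem_singleton] at ha hb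
      rcases ha with rfl | rfl <;> rcases hb with rfl | rfl
      · omega
      · rfl
      · omega
      · omega
    · intro I hI
      simp only [indepSets, Finset.mem_filter] at hI
      obtain ⟨a, b, hab, rfl⟩ := Finset.card_eq_two.1 hI.2.1
      have h1 := hI.2.2 a (by simp) b (by simp)
      have h2 := hI.2.2 b (by simp) a (by simp)
      rcases lt_or_gt_of_ne (fun h => hab (r.injective h)) with h | h
      · exact ⟨(b, a), by simp [h, h2, h1, hab], Finset.pair_comm _ _⟩
      · exact ⟨(a, b), by simp [h, h2, hab.symm], rfl⟩
    · rintro ⟨v, u⟩ h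
      simp only [Finset.mem_filter, SimpleGraph.compl_adj] at h
      rw [Finset.prod_pair h.2.1.1.symm, mul_comm]
  · intro u v h
    have h2 : r u ≠ r v := fun h' => h.ne (r.injective h')
    omega

theorem lPoly_big (h : Gᶜ.CliqueFree 3) (r : ℕ) (hr : 3 ≤ r) : lPoly G r = 0 := by
  rw [lPoly, Finset.sum_eq_zero]
  intro I hI
  exfalso
  simp only [indepSets, Finset.mem_filter] at hI
  refine h.mono hr I ⟨?_, hI.2.1⟩
  intro u hu v hv huv
  exact (SimpleGraph.compl_adj _ _ _).2 ⟨huv, hI.2.2 u hu v hv⟩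

/-- The exponent of the squarefree monomial of all variables. -/
noncomputable def oneExp (V : Type) [Fintype V] : V →₀ ℕ := Finsupp.equivFunOnFinite.symm (fun _ => 1)

theorem coeff_prod_lPoly (d : ℕ+ →₀ ℕ) :
    MvPowerSeries.coeff d (chromaticSymmetricFunction G) =
      (∏ i ∈ d.support, lPoly G (d i)).coeff (oneExp V) := by
  have hmon : ∀ f : d.support → Finset V, (∏ i, ∏ v ∈ f i, MvPolynomial.X v : MvPolynomial V ℚ) =
      MvPolynomial.monomial (∑ i, ∑ v ∈ f i, Finsupp.single v 1) 1 := by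
    intro f
    simp only [MvPolynomial.X, MvPolynomial.monomial_sum_one]
  have hexp : ∀ f : d.support → Finset V, (∑ i, ∑ v ∈ f i, Finsupp.single v 1 = oneExp V) ↔
      ∀ v, ∃! i, v ∈ f i := by
    intro f
    rw [Finsupp.ext_iff]
    refine forall_congr' fun v => ?_
    have : (∑ i, ∑ v ∈ f i, Finsupp.single v 1 : V →₀ ℕ) v =
        (Finset.univ.filter (fun i => v ∈ f i)).card := by
      simp [Finsupp.finsetSum_apply, Finsupp.single_apply]
    rw [this]
    simp only [oneExp, Finsupp.equivFunOnFinite_symm_apply_apply, Finset.card_eq_one]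
    constructor
    · rintro ⟨i, hi⟩
      refine ⟨i, ?_, ?_⟩
      · have : i ∈ Finset.univ.filter (fun i => v ∈ f i) := by rw [hi]; simp
        simpa using this
      · intro j hj
        have : j ∈ Finset.univ.filter (fun i => v ∈ f i) := by simpa using hj
        rw [hi] at this; simpa using this
    · rintro ⟨i, hi, hj⟩
      refine ⟨i, ?_⟩
      ext j
      simp only [Finset.mem_filter, Finset.mem_univ, true_and, Finset.mem_singleton]
      exact ⟨hj j, fun h => h ▸ hi⟩
  rw [← Finset.prod_coe_sort]
  simp only [lPoly]
  rw [Finset.prod_univ_sum, MvPolynomial.coeff_sum]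
  simp only [hmon, MvPolynomial.coeff_monomial, hexp]
  rw [Finset.sum_boole]
  change ((Nat.card _ : ℕ) : ℚ) = _
  congr 1
  set F := (Fintype.piFinset fun i : d.support => indepSets G (d ↑i)).filter
    (fun f => ∀ v, ∃! i, v ∈ f i) with hF
  have hmem : ∀ f, f ∈ F ↔ (∀ i : d.support, (f i).card = d i ∧ ∀ u ∈ f i, ∀ v ∈ f i, ¬ G.Adj u v) ∧
      ∀ v, ∃! i, v ∈ f i := by
    intro f
    simp [hF, indepSets, Fintype.mem_piFinset]
  clear_value F
  rw [← Nat.card_eq_finsetCard]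
  symm
  have hk : ∀ (κ : V → ℕ+) (i : ℕ+), Nat.card {v : V // κ v = i} =
      (Finset.univ.filter (fun v => κ v = i)).card := by
    intro κ i
    rw [Nat.card_eq_fintype_card, Fintype.card_subtype]
  have hch : ∀ f : F, ∀ v, ∃ i : d.support, v ∈ f.1 i ∧ ∀ j : d.support, v ∈ f.1 j → j = i :=
    fun f v => ((hmem f.1).1 f.2).2 v
  choose c hc1 hc2 using hch
  have hfib : ∀ (f : F) (i : d.support), Finset.univ.filter (fun v => (c f v : ℕ+) = i) = f.1 i := by
    intro f i
    ext v
    simp only [Finset.mem_filter, Finset.mem_univ, true_and]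
    constructor
    · intro h
      rw [← Subtype.ext h]; exact hc1 f v
    · intro h
      rw [hc2 f v i h]
  refine Nat.card_eq_of_bijective (fun f => ⟨fun v => (c f v : ℕ+), ?_, ?_⟩) ⟨?_, ?_⟩
  · intro u v huv he
    have he := Subtype.ext he
    refine (((hmem f.1).1 f.2).1 (c f u)).2 u (hc1 f u) v ?_ huv
    rw [he]; exact hc1 f v
  · intro i
    rw [hk]
    by_cases hi : i ∈ d.support
    · rw [← (((hmem f.1).1 f.2).1 ⟨i, hi⟩).1, ← hfib f ⟨i, hi⟩]
    · rw [Finsupp.notMem_support_iff.1 hi, Finset.card_eq_zero, Finset.filter_eq_empty_iff]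
      intro v _ h
      exact hi (h ▸ (c f v).2)
  · intro f g hfg
    have hfg' : ∀ v, (c f v : ℕ+) = c g v := fun v => congrFun (congrArg Subtype.val hfg) v
    refine Subtype.ext (funext fun i => ?_)
    rw [← hfib f i, ← hfib g i]
    simp only [hfg']
  · rintro ⟨κ, h1, h2⟩
    have hs : ∀ v, κ v ∈ d.support := by
      intro v
      rw [Finsupp.mem_support_iff, ← h2, hk, Finset.card_ne_zero]
      exact ⟨v, by simp⟩
    let f : d.support → Finset V := fun i => Finset.univ.filter (fun v => κ v = i)
    have hf : f ∈ F := by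
      rw [hmem]
      refine ⟨fun i => ⟨?_, ?_⟩, fun v => ⟨⟨κ v, hs v⟩, ?_, ?_⟩⟩
      · rw [← h2, hk]
      · intro u hu v hv huv
        simp only [f, Finset.mem_filter] at hu hv
        exact h1 u v huv (hu.2.trans hv.2.symm)
      · simp [f]
      · intro j hj
        simp only [f, Finset.mem_filter] at hj
        exact Subtype.ext hj.2.symm
    refine ⟨⟨f, hf⟩, Subtype.ext (funext fun v => ?_)⟩
    have := hc1 ⟨f, hf⟩ v
    simp only [f, Finset.mem_filter] at this
    exact this.2.symm

theorem coeff_eq_zero_of_degree (d : ℕ+ →₀ ℕ) (hd : d.degree ≠ Fintype.card V) :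
    MvPowerSeries.coeff d (chromaticSymmetricFunction G) = 0 := by
  change ((Nat.card _ : ℕ) : ℚ) = 0
  rw [Nat.cast_eq_zero, Nat.card_eq_zero]
  left
  refine ⟨fun ⟨κ, _, h2⟩ => hd ?_⟩
  have hk : ∀ (i : ℕ+), (Finset.univ.filter (fun v => κ v = i)).card = d i := by
    intro i
    rw [← h2, Nat.card_eq_fintype_card, Fintype.card_subtype]
  have hs : ∀ v ∈ (Finset.univ : Finset V), κ v ∈ d.support := by
    intro v _
    rw [Finsupp.mem_support_iff, ← hk, Finset.card_ne_zero]
    exact ⟨v, by simp⟩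
  rw [← Finset.card_univ, Finset.card_eq_sum_card_fiberwise hs, Finsupp.degree_apply]
  exact Finset.sum_congr rfl fun i _ => (hk i).symm

end count

section esym

/-- The squarefree pairs summing to `d`. -/
noncomputable def sqPairs (d : ℕ+ →₀ ℕ) : Finset ((ℕ+ →₀ ℕ) × (ℕ+ →₀ ℕ)) :=
  (Finset.HasAntidiagonal.antidiagonal d).filter (fun x => (∀ i, x.1 i ≤ 1) ∧ ∀ i, x.2 i ≤ 1)

theorem coeff_esym_mul (a b : ℕ) (d : ℕ+ →₀ ℕ) :
    MvPowerSeries.coeff d (elementarySymmetric a * elementarySymmetric b) =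
      ∑ x ∈ sqPairs d, if x.1.support.card = a ∧ x.2.support.card = b then 1 else 0 := by
  rw [MvPowerSeries.coeff_mul, sqPairs, Finset.sum_filter]
  refine Finset.sum_congr rfl fun x _ => ?_
  change (if _ then (1 : ℚ) else 0) * (if _ then (1 : ℚ) else 0) = _
  by_cases h1 : ∀ i, x.1 i ≤ 1 <;> by_cases h2 : ∀ i, x.2 i ≤ 1 <;>
    by_cases h3 : x.1.support.card = a <;> by_cases h4 : x.2.support.card = b <;>
    simp [h1, h2, h3, h4]

theorem sq_degree (x : ℕ+ →₀ ℕ) (h : ∀ i, x i ≤ 1) : x.degree = x.support.card := by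
  rw [Finsupp.degree_apply, Finset.card_eq_sum_ones]
  refine Finset.sum_congr rfl fun i hi => ?_
  have := Finsupp.mem_support_iff.1 hi
  have := h i
  omega

theorem sqPairs_degree (d : ℕ+ →₀ ℕ) (x) (hx : x ∈ sqPairs d) :
    x.1.support.card + x.2.support.card = d.degree := by
  simp only [sqPairs, Finset.mem_filter, Finset.HasAntidiagonal.mem_antidiagonal] at hx
  rw [← sq_degree _ hx.2.1, ← sq_degree _ hx.2.2, ← map_add, hx.1]

theorem sqPairs_sum {M : Type} [AddCommMonoid M] (d : ℕ+ →₀ ℕ) (hd : ∀ i, d i ≤ 2) (s : ℕ → ℕ → M) :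
    ∑ x ∈ sqPairs d, s x.1.support.card x.2.support.card =
      ∑ A ∈ (d.support.filter (fun i => d i = 1)).powerset,
        s ((d.support.filter (fun i => d i = 2)).card + A.card)
          ((d.support.filter (fun i => d i = 2)).card +
            ((d.support.filter (fun i => d i = 1)).card - A.card)) := by
  set O := d.support.filter (fun i => d i = 1) with hO
  set T := d.support.filter (fun i => d i = 2) with hT
  have hOm : ∀ i, i ∈ O ↔ d i = 1 := by intro i; simp [hO]; omega
  have hTm : ∀ i, i ∈ T ↔ d i = 2 := by intro i; simp [hT]; omega
  have hOT : Disjoint T O := by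
    rw [Finset.disjoint_left]; intro i h1 h2
    rw [hTm] at h1; rw [hOm] at h2; omega
  have hval : ∀ (S : Finset ℕ+) i, (Finsupp.indicator S (fun _ _ => 1) : ℕ+ →₀ ℕ) i = if i ∈ S then 1 else 0 := by
    intro S i
    rw [Finsupp.indicator_apply]; simp
  have hsup : ∀ (S : Finset ℕ+), (Finsupp.indicator S (fun _ _ => 1) : ℕ+ →₀ ℕ).support = S := by
    intro S; ext i; rw [Finsupp.mem_support_iff, hval]; simp
  symm
  refine Finset.sum_bij (fun A _ => (Finsupp.indicator (T ∪ A) (fun _ _ => 1),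
    Finsupp.indicator (T ∪ (O \ A)) (fun _ _ => 1))) ?_ ?_ ?_ ?_
  · intro A hA
    have hA := Finset.mem_powerset.1 hA
    simp only [sqPairs, Finset.mem_filter, Finset.HasAntidiagonal.mem_antidiagonal, hval]
    refine ⟨?_, ?_, ?_⟩
    · ext i
      have h1 := hOm i
      have h2 := hTm i
      have h3 := hd i
      have h4 := @hA i
      simp only [Finsupp.add_apply, hval, Finset.mem_union, Finset.mem_sdiff]
      by_cases hi : i ∈ T
      · simp [hi]; have := h2.1 hi; omega
      · by_cases hi' : i ∈ A
        · have := h1.1 (h4 hi'); simp [hi, hi', this]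
        · by_cases ho : i ∈ O
          · have := h1.1 ho; simp [hi, hi', ho, this]
          · simp [hi, hi', ho]
            have a1 : d i ≠ 1 := fun h => ho (h1.2 h)
            have a2 : d i ≠ 2 := fun h => hi (h2.2 h)
            omega
    · intro i; split_ifs <;> simp
    · intro i; split_ifs <;> simp
  · intro A hA B hB h
    have hA := Finset.mem_powerset.1 hA
    have hB := Finset.mem_powerset.1 hB
    have h1 := congrArg (fun x => x.1.support) h
    simp only [hsup] at h1
    have e : ∀ C, C ⊆ O → (T ∪ C) ∩ O = C := by
      intro C hC
      rw [Finset.union_inter_distrib_right, Finset.disjoint_iff_inter_eq_empty.1 hOT,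
        Finset.inter_eq_left.2 hC]; simp
    rw [← e A hA, ← e B hB, h1]
  · rintro ⟨x, y⟩ h
    simp only [sqPairs, Finset.mem_filter, Finset.HasAntidiagonal.mem_antidiagonal] at h
    obtain ⟨hxy, hx, hy⟩ := h
    have hs : ∀ i, x i + y i = d i := fun i => by rw [← hxy]; rfl
    refine ⟨O.filter (fun i => x i = 1), by simp, ?_⟩
    refine Prod.ext ?_ ?_
    · ext i
      have h1 := hs i; have h2 := hx i; have h3 := hy i
      simp only [hval, Finset.mem_union, Finset.mem_filter, hOm, hTm]
      split_ifs <;> omega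
    · ext i
      have h1 := hs i; have h2 := hx i; have h3 := hy i
      simp only [hval, Finset.mem_union, Finset.mem_filter, Finset.mem_sdiff, hOm, hTm]
      split_ifs <;> omega
  · intro A hA
    have hA := Finset.mem_powerset.1 hA
    rw [hsup, hsup, Finset.card_union_of_disjoint (hOT.mono_right hA),
      Finset.card_union_of_disjoint (hOT.mono_right Finset.sdiff_subset),
      Finset.card_sdiff_of_subset hA]

theorem esym_zero : elementarySymmetric 0 = 1 := by
  ext d
  rw [MvPowerSeries.coeff_one]
  change (if _ then (1 : ℚ) else 0) = _
  by_cases h : d = 0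
  · simp [h]
  · simp [h]

/-- The partition with parts `j` and `n - j`. -/
def twoPart (n j : ℕ) (h : j ≤ n) : n.Partition := Nat.Partition.ofSums n {j, n - j} (by simp; omega)

theorem esym_twoPart (n j : ℕ) (h : j ≤ n) :
    elementarySymmetricPartition (twoPart n j h) =
      elementarySymmetric j * elementarySymmetric (n - j) := by
  have key : ∀ s : Multiset ℕ, ((s.filter (· ≠ 0)).map elementarySymmetric).prod =
      (s.map elementarySymmetric).prod := by
    intro s
    induction s using Multiset.induction_on with
    | empty => simp
    | cons a s ih =>
      by_cases ha : a = 0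
      · rw [Multiset.filter_cons_of_neg _ (by simpa using ha), ih]
        simp [ha, esym_zero]
      · rw [Multiset.filter_cons_of_pos (p := (· ≠ 0)) _ ha]
        simp only [Multiset.map_cons, Multiset.prod_cons, ih]
  have := key {j, n - j}
  simp only [Multiset.insert_eq_cons, Multiset.map_cons, Multiset.prod_cons, Multiset.map_singleton,
    Multiset.prod_singleton] at this
  rw [← this, elementarySymmetricPartition, twoPart, Nat.Partition.ofSums_parts]
  congr!

end esym

/-- If the complement of a finite simple graph contains no triangle, then the graph
is e-positive. -/
theorem complement_triangleFree_ePositive {V : Type} [Fintype V] (G : SimpleGraph V)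
    (h : Gᶜ.CliqueFree 3) : EPositive G := by
  set n := Fintype.card V with hn
  let s : ℕ → ℕ → MvPolynomial V ℚ := sSeq (pPoly V) (qPoly Gᶜ)
  let b : ℕ → ℚ := fun j => 1 / 2 * (s j (n - j)).coeff (oneExp V)
  have hb : ∀ j, 0 ≤ b j := fun j => mul_nonneg (by norm_num) (sSeq_pos Gᶜ h _ _ _)
  refine ⟨fun lam => ∑ j : Fin (n + 1), if twoPart n j (by omega) = lam then b j else 0, ?_, ?_⟩
  · intro lam
    refine Finset.sum_nonneg fun j _ => ?_
    split_ifs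
    · exact hb _
    · exact le_rfl
  have hR : ∑ lam : n.Partition, (∑ j : Fin (n + 1), if twoPart n j (by omega) = lam then b j else 0) •
      elementarySymmetricPartition lam =
      ∑ j : Fin (n + 1), b j • (elementarySymmetric j * elementarySymmetric (n - j)) := by
    simp only [Finset.sum_smul]
    rw [Finset.sum_comm]
    refine Finset.sum_congr rfl fun j _ => ?_
    simp only [ite_smul, zero_smul, Finset.sum_ite_eq, Finset.mem_univ, if_true]
    rw [esym_twoPart]
  refine Eq.trans ?_ hR.symm
  ext d
  have hR2 : MvPowerSeries.coeff d
      (∑ j : Fin (n + 1), b j • (elementarySymmetric j * elementarySymmetric (n - j))) =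
      ∑ x ∈ sqPairs d, if d.degree = n then
        1 / 2 * (s x.1.support.card x.2.support.card).coeff (oneExp V) else 0 := by
    rw [map_sum]
    simp only [map_smul, coeff_esym_mul, smul_eq_mul, Finset.mul_sum]
    rw [Finset.sum_comm]
    refine Finset.sum_congr rfl fun x hx => ?_
    have hx := sqPairs_degree d x hx
    split_ifs with hdn
    · rw [Finset.sum_eq_single (⟨x.1.support.card, by omega⟩ : Fin (n + 1))]
      · have : x.2.support.card = n - x.1.support.card := by omega
        simp only [this, b]; simp
      · intro j _ hj
        rw [if_neg, mul_zero]
        rintro ⟨h1, _⟩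
        exact hj (Fin.ext h1.symm)
      · simp
    · refine Finset.sum_eq_zero fun j _ => ?_
      rw [if_neg, mul_zero]
      rintro ⟨h1, h2⟩
      have := j.2
      omega
  rw [hR2]
  by_cases hdn : d.degree = n
  swap
  · simp only [hdn, if_false, Finset.sum_const_zero]
    exact coeff_eq_zero_of_degree G d hdn
  simp only [hdn, if_true]
  rw [coeff_prod_lPoly]
  by_cases hd : ∀ i, d i ≤ 2
  · rw [← Finset.mul_sum, ← MvPolynomial.coeff_sum, sqPairs_sum d hd s]
    simp only [s]
    rw [← pow_mul_sSeq]
    set O := d.support.filter (fun i => d i = 1) with hO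
    set T := d.support.filter (fun i => d i = 2) with hT
    have hprod : ∏ i ∈ d.support, lPoly G (d i) = pPoly V ^ O.card * qPoly Gᶜ ^ T.card := by
      rw [← Finset.prod_filter_mul_prod_filter_not d.support (fun i => d i = 1)]
      congr 1
      · rw [Finset.prod_congr rfl (g := fun _ => pPoly V), Finset.prod_const]
        intro i hi
        rw [(Finset.mem_filter.1 hi).2, lPoly_one]
      · have : d.support.filter (fun i => ¬ d i = 1) = T := by
          ext i
          have := hd i
          simp [hT]; omega
        rw [this, Finset.prod_congr rfl (g := fun _ => qPoly Gᶜ), Finset.prod_const]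
        intro i hi
        rw [(Finset.mem_filter.1 hi).2, lPoly_two]
    rw [hprod]
    have h2 : (2 : MvPolynomial V ℚ) = MvPolynomial.C 2 := (map_ofNat MvPolynomial.C 2).symm
    have h3 : pPoly V ^ O.card * sSeq (pPoly V) (qPoly Gᶜ) T.card T.card =
        MvPolynomial.C 2 * (pPoly V ^ O.card * qPoly Gᶜ ^ T.card) := by
      simp only [sSeq, min_self, max_self, Nat.sub_self, pSeq]
      rw [← h2]; ring
    rw [h3, MvPolynomial.coeff_C_mul]; ring
  · push Not at hd
    obtain ⟨i, hi⟩ := hd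
    rw [Finset.prod_eq_zero (i := i) (Finsupp.mem_support_iff.2 (by omega)) (lPoly_big G h _ hi)]
    have : sqPairs d = ∅ := by
      rw [Finset.eq_empty_iff_forall_notMem]
      intro x hx
      simp only [sqPairs, Finset.mem_filter, Finset.HasAntidiagonal.mem_antidiagonal] at hx
      have h1 := hx.2.1 i
      have h2 := hx.2.2 i
      have h3 : x.1 i + x.2 i = d i := by rw [← hx.1]; rfl
      omega
    rw [this]; simp
end

section
/- Let G be a connected finite simple graph on n vertices whose independence number (the maximum size of a set of pairwise nonadjacent vertices) equals ⌈n/2⌉ + 1. Then G is not e-positive; that is, the chromatic symmetric function X_G cannot be written as a linear combination with nonnegative rational coefficients of the elementary symmetric functions e_λ over partitions λ of n. -/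
open scoped Classical

/-- The independence number of `G`: the maximum size of a set of pairwise nonadjacent
vertices. -/
noncomputable def independenceNumber {V : Type} [Fintype V] (G : SimpleGraph V) : ℕ :=
  Finset.univ.sup fun S : Finset V =>
    if (S : Set V).Pairwise (fun u v => ¬ G.Adj u v) then S.card else 0


/-! ### Truncation to finitely many colors -/

/-- The chromatic symmetric polynomial with colors in a finite type `C`. -/
noncomputable def chromPoly (C : Type) [Fintype C] {W : Type} [Fintype W] (H : SimpleGraph W) :
    MvPolynomial C ℚ :=
  ∑ κ : W → C, if (∀ u v, H.Adj u v → κ u ≠ κ v) then ∏ v, MvPolynomial.X (κ v) else 0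

theorem content_eq {C W : Type} [Fintype C] [Fintype W] (κ : W → C) (d : C →₀ ℕ) :
    (∑ v, Finsupp.single (κ v) 1 : C →₀ ℕ) = d ↔ ∀ i, Nat.card {v : W // κ v = i} = d i := by
  rw [Finsupp.ext_iff]
  refine forall_congr' fun i => ?_
  rw [Finsupp.finsetSum_apply, Nat.card_eq_fintype_card, Fintype.card_subtype,
    Finset.card_filter]
  simp only [Finsupp.single_apply]

theorem prod_X_eq {C W : Type} [Fintype W] (κ : W → C) :
    (∏ v, MvPolynomial.X (κ v) : MvPolynomial C ℚ)
      = MvPolynomial.monomial (∑ v, Finsupp.single (κ v) 1) 1 := by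
  rw [MvPolynomial.monomial_sum_one]
  rfl

theorem coeff_chromPoly {C W : Type} [Fintype C] [Fintype W] (H : SimpleGraph W) (d : C →₀ ℕ) :
    MvPolynomial.coeff d (chromPoly C H) =
      (Nat.card {κ : W → C // (∀ u v, H.Adj u v → κ u ≠ κ v) ∧
        ∀ i, Nat.card {v : W // κ v = i} = d i} : ℚ) := by
  rw [chromPoly, MvPolynomial.coeff_sum, Nat.card_eq_fintype_card, Fintype.card_subtype,
    Finset.card_filter]
  push_cast
  refine Finset.sum_congr rfl fun κ _ => ?_
  simp only [← content_eq]
  by_cases h : (∀ u v, H.Adj u v → κ u ≠ κ v)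
  · rw [if_pos h, prod_X_eq, MvPolynomial.coeff_monomial]
    exact if_congr ⟨fun h' => ⟨h, h'⟩, fun h' => h'.2⟩ rfl rfl
  · rw [if_neg h, if_neg (fun h' => h h'.1)]
    simp

theorem killCompl_chrom {C W : Type} [Fintype C] [Fintype W] (ι : C ↪ ℕ+) (H : SimpleGraph W) :
    MvPowerSeries.killCompl ι (chromaticSymmetricFunction H) =
      (chromPoly C H : MvPowerSeries C ℚ) := by
  ext d
  rw [MvPowerSeries.coeff_killCompl, MvPolynomial.coeff_coe, coeff_chromPoly]
  change (Nat.card _ : ℚ) = _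
  congr 1
  symm
  refine Nat.card_congr (Equiv.ofBijective (fun κ => ⟨fun w => ι (κ.1 w), ?_, ?_⟩) ⟨?_, ?_⟩)
  · intro u v h h'
    exact κ.2.1 u v h (ι.injective h')
  · intro i
    by_cases hi : i ∈ Set.range ι
    · obtain ⟨j, rfl⟩ := hi
      rw [Finsupp.embDomain_apply_self, ← κ.2.2 j]
      simp
    · rw [Finsupp.embDomain_of_notMem_range _ _ _ hi]
      have : IsEmpty {v : W // ι (κ.1 v) = i} := ⟨fun v => hi ⟨_, v.2⟩⟩
      exact Nat.card_of_isEmpty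
  · intro κ κ' h
    ext w
    have := congrFun (congrArg Subtype.val h) w
    exact ι.injective this
  · rintro ⟨κ, h1, h2⟩
    have hr : ∀ w, κ w ∈ Set.range ι := by
      intro w
      by_contra hi
      have := h2 (κ w)
      rw [Finsupp.embDomain_of_notMem_range _ _ _ hi] at this
      have h3 : Nonempty {v : W // κ v = κ w} := ⟨⟨w, rfl⟩⟩
      exact (Nat.card_pos (α := {v : W // κ v = κ w})).ne' this
    choose κ' hκ' using hr
    refine ⟨⟨κ', ?_, ?_⟩, ?_⟩
    · intro u v h h'
      exact h1 u v h (by rw [← hκ', ← hκ', h'])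
    · intro i
      have := h2 (ι i)
      rw [Finsupp.embDomain_apply_self] at this
      rw [← this]
      simp [← hκ']
    · ext w
      simp [hκ']

theorem killCompl_elem {C : Type} [Fintype C] (ι : C ↪ ℕ+) (m : ℕ) :
    MvPowerSeries.killCompl ι (elementarySymmetric m) =
      (MvPolynomial.esymm C ℚ m : MvPowerSeries C ℚ) := by
  ext d
  rw [MvPowerSeries.coeff_killCompl, MvPolynomial.coeff_coe]
  change (if _ then (1:ℚ) else 0) = _
  rw [MvPolynomial.esymm_eq_sum_monomial, MvPolynomial.coeff_sum]
  simp only [MvPolynomial.coeff_monomial]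
  rw [Finset.sum_boole]
  have key : ∀ s : Finset C, (∑ i ∈ s, Finsupp.single i 1 : C →₀ ℕ) = d ↔
      ((∀ i, d i ≤ 1) ∧ d.support = s) := by
    intro s
    have e : ∀ i, (∑ i ∈ s, Finsupp.single i 1 : C →₀ ℕ) i = if i ∈ s then 1 else 0 := by
      intro i
      rw [Finsupp.finsetSum_apply]
      simp [Finsupp.single_apply]
    constructor
    · rintro rfl
      refine ⟨fun i => ?_, ?_⟩
      · rw [e]; split_ifs <;> simp
      · ext i
        rw [Finsupp.mem_support_iff, e]
        simp
    · rintro ⟨h, rfl⟩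
      ext i
      rw [e]
      have := h i
      split_ifs with h'
      · have := Finsupp.mem_support_iff.1 h'
        omega
      · exact (Finsupp.notMem_support_iff.1 h').symm
  have hd : (∀ i, (Finsupp.embDomain ι d) i ≤ 1) ↔ ∀ i, d i ≤ 1 := by
    constructor
    · intro h i
      have := h (ι i)
      rwa [Finsupp.embDomain_apply_self] at this
    · intro h i
      by_cases hi : i ∈ Set.range ι
      · obtain ⟨j, rfl⟩ := hi
        rw [Finsupp.embDomain_apply_self]; exact h j
      · rw [Finsupp.embDomain_of_notMem_range _ _ _ hi]; simp
  rw [hd, Finsupp.support_embDomain, Finset.card_map]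
  split_ifs with h
  · symm
    rw [Nat.cast_eq_one, Finset.card_eq_one]
    refine ⟨d.support, ?_⟩
    ext s
    simp only [Finset.mem_filter, Finset.mem_powersetCard_univ, Finset.mem_singleton, key]
    constructor
    · rintro ⟨_, _, h⟩; exact h.symm
    · rintro rfl; exact ⟨h.2, h.1, rfl⟩
  · symm
    rw [Nat.cast_eq_zero, Finset.card_eq_zero]
    ext s
    simp only [Finset.mem_filter, Finset.mem_powersetCard_univ, key]
    constructor
    · rintro ⟨h1, h2, h3⟩
      exact (h ⟨h2, by rw [h3, h1]⟩).elim
    · intro h; simp at h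

/-- The truncated version of an `e`-expansion. -/
theorem trunc_expansion {V : Type} [Fintype V] (G : SimpleGraph V)
    (c : (Fintype.card V).Partition → ℚ)
    (h : chromaticSymmetricFunction G =
      ∑ lam : (Fintype.card V).Partition, c lam • elementarySymmetricPartition lam)
    (C : Type) [Fintype C] :
    chromPoly C G = ∑ lam : (Fintype.card V).Partition,
      c lam • (lam.parts.map (MvPolynomial.esymm C ℚ)).prod := by
  obtain ⟨ι⟩ : Nonempty (C ↪ ℕ+) := by
    refine ⟨⟨fun x => Nat.succPNat (Fintype.equivFin C x), ?_⟩⟩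
    intro x y hxy
    have := Nat.succPNat_injective hxy
    exact (Fintype.equivFin C).injective (Fin.ext this)
  have h2 := congrArg (MvPowerSeries.killCompl (R := ℚ) ι) h
  rw [killCompl_chrom, map_sum] at h2
  apply MvPolynomial.coe_injective
  rw [h2]
  change _ = MvPolynomial.coeToMvPowerSeries.ringHom _
  rw [map_sum]
  refine Finset.sum_congr rfl fun lam _ => ?_
  rw [map_smul, elementarySymmetricPartition, map_multiset_prod, Multiset.map_map]
  rw [MvPolynomial.smul_eq_C_mul, map_mul, map_multiset_prod, Multiset.map_map]
  simp only [Function.comp_def, killCompl_elem]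
  rw [MvPowerSeries.smul_eq_C_mul]
  simp

/-! ### The linear coefficient of the chromatic polynomial -/

/-- The number of proper colorings with `q` colors. -/
noncomputable def numColorings {V : Type} [Fintype V] (G : SimpleGraph V) (q : ℕ) : ℕ :=
  (Finset.univ.filter fun κ : V → Fin q => ∀ u v, G.Adj u v → κ u ≠ κ v).card

/-- Contraction of `u` into `v`. -/
noncomputable def contractMap {V : Type} (u : V) (v : {w : V // w ≠ u}) (w : V) : {w : V // w ≠ u} :=
  if h : w = u then v else ⟨w, h⟩

/-- The contracted graph. -/
def contractGraph {V : Type} (G : SimpleGraph V) (u : V) (v : {w : V // w ≠ u}) :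
    SimpleGraph {w : V // w ≠ u} where
  Adj x y := x ≠ y ∧ ∃ a b, contractMap u v a = x ∧ contractMap u v b = y ∧ G.Adj a b
  symm := ⟨by
    rintro x y ⟨h, a, b, h1, h2, h3⟩
    exact ⟨h.symm, b, a, h2, h1, h3.symm⟩⟩
  loopless := ⟨fun x h => h.1 rfl⟩

theorem contractMap_coe {V : Type} (u : V) (v : {w : V // w ≠ u}) (w : {w : V // w ≠ u}) :
    contractMap u v w = w := by
  simp [contractMap, w.2]

theorem contractMap_self {V : Type} (u : V) (v : {w : V // w ≠ u}) :
    contractMap u v u = v := by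
  simp [contractMap]

theorem contract_connected {V : Type} (G : SimpleGraph V) (u : V) (v : {w : V // w ≠ u})
    (h : G.Connected) : (contractGraph G u v).Connected := by
  have key : ∀ a b : V, G.Reachable a b →
      (contractGraph G u v).Reachable (contractMap u v a) (contractMap u v b) := by
    intro a b hab
    obtain ⟨p⟩ := hab
    induction p with
    | nil => exact SimpleGraph.Reachable.refl _
    | @cons a b c hadj p ih =>
      refine SimpleGraph.Reachable.trans ?_ ih
      by_cases he : contractMap u v a = contractMap u v b
      · rw [he]
      · exact SimpleGraph.Adj.reachable (G := contractGraph G u v) ⟨he, a, b, rfl, rfl, hadj⟩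
  have : Nonempty {w : V // w ≠ u} := ⟨v⟩
  refine SimpleGraph.Connected.mk ?_
  intro x y
  have := key x y (h.preconnected _ _)
  rwa [contractMap_coe, contractMap_coe] at this

theorem numColorings_delete {V : Type} [Fintype V] (G : SimpleGraph V) (u : V)
    (v : {w : V // w ≠ u}) (huv : G.Adj u v) (q : ℕ) :
    numColorings (G.deleteEdges {s(u, v.1)}) q =
      numColorings G q + numColorings (contractGraph G u v) q := by
  unfold numColorings
  rw [← Finset.card_filter_add_card_filter_not (fun κ : V → Fin q => κ u ≠ κ v)]
  congr 1
  · congr 1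
    ext κ
    simp only [Finset.mem_filter, Finset.mem_univ, true_and, SimpleGraph.deleteEdges_adj,
      Set.mem_singleton_iff]
    constructor
    · rintro ⟨h1, h2⟩ a b hab
      by_cases he : s(a, b) = s(u, v.1)
      · rw [Sym2.eq_iff] at he
        rcases he with ⟨rfl, rfl⟩ | ⟨rfl, rfl⟩
        · exact h2
        · exact h2.symm
      · exact h1 a b ⟨hab, he⟩
    · intro h
      exact ⟨fun a b hab => h a b hab.1, h u v huv⟩
  · symm
    refine Finset.card_bij (fun κ _ w => κ (contractMap u v w)) ?_ ?_ ?_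
    · intro κ hκ
      simp only [Finset.mem_filter, Finset.mem_univ, true_and, SimpleGraph.deleteEdges_adj,
        Set.mem_singleton_iff, not_not] at hκ ⊢
      refine ⟨?_, by rw [contractMap_coe, contractMap_self]⟩
      rintro a b ⟨hab, hne⟩
      refine hκ _ _ ⟨?_, a, b, rfl, rfl, hab⟩
      intro he
      apply hne
      unfold contractMap at he
      rw [Sym2.eq_iff]
      split_ifs at he with h1 h2 h2
      · exact (hab.ne (h1.trans h2.symm)).elim
      · left; exact ⟨h1, by rw [he]⟩
      · right; exact ⟨by rw [← he], h2⟩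
      · exact (hab.ne (congrArg Subtype.val he)).elim
    · intro κ _ κ' _ h
      ext1 w
      have := congrFun h w
      simpa only [contractMap_coe] using this
    · intro κ hκ
      simp only [Finset.mem_filter, Finset.mem_univ, true_and, SimpleGraph.deleteEdges_adj,
        Set.mem_singleton_iff, not_not] at hκ
      obtain ⟨h1, h2⟩ := hκ
      have hc : ∀ w, κ (contractMap u v w).1 = κ w := by
        intro w
        unfold contractMap
        split_ifs with h
        · rw [h, h2]
        · rfl
      refine ⟨fun w => κ w, ?_, ?_⟩
      · simp only [Finset.mem_filter, Finset.mem_univ, true_and]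
        rintro x y ⟨hne, a, b, rfl, rfl, hab⟩
        rw [hc, hc]
        refine h1 a b ⟨hab, ?_⟩
        intro he
        apply hne
        rw [Sym2.eq_iff] at he
        rcases he with ⟨rfl, rfl⟩ | ⟨rfl, rfl⟩
        · rw [contractMap_coe, contractMap_self]
        · rw [contractMap_coe, contractMap_self]
      · funext w
        exact hc w

theorem chromaticPolynomial_exists (n : ℕ) : ∀ (m : ℕ) (V : Type) [Fintype V] (G : SimpleGraph V),
    Fintype.card V = n + 1 → Nat.card G.edgeSet = m →
    ∃ P : Polynomial ℚ, (∀ q : ℕ, P.eval (q : ℚ) = numColorings G q) ∧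
      0 ≤ (-1) ^ n * P.coeff 1 ∧ (G.Connected → 0 < (-1) ^ n * P.coeff 1) := by
  induction n with
  | zero =>
    intro m V _ G hV _
    refine ⟨Polynomial.X, ?_, by simp, by simp⟩
    intro q
    have hs : Subsingleton V := Fintype.card_le_one_iff_subsingleton.1 (by omega)
    have : ∀ κ : V → Fin q, ∀ u v, G.Adj u v → κ u ≠ κ v := fun κ u v h =>
      (h.ne (Subsingleton.elim _ _)).elim
    rw [numColorings, Finset.filter_true_of_mem (fun κ _ => this κ)]
    simp [hV]
  | succ n ihn =>
    intro m
    induction m using Nat.strong_induction_on with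
    | _ m ihm =>
    intro V _ G hV hm
    by_cases hG : G = ⊥
    · refine ⟨Polynomial.X ^ (n + 2), ?_, ?_, ?_⟩
      · intro q
        rw [numColorings, Finset.filter_true_of_mem (fun κ _ => by simp [hG])]
        simp [hV]
      · simp [Polynomial.coeff_X_pow]
      · intro h
        exfalso
        rw [hG] at h
        have h2 := h.preconnected
        have : Nontrivial V := Fintype.one_lt_card_iff_nontrivial.1 (by omega)
        obtain ⟨a, b, hab⟩ := exists_pair_ne V
        exact hab (SimpleGraph.reachable_bot.1 (h2 a b))
    · obtain ⟨u, v, huv⟩ := SimpleGraph.ne_bot_iff_exists_adj.1 hG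
      have hcard : Nat.card (G.deleteEdges {s(u, v)}).edgeSet < m := by
        rw [← hm]
        simp only [SimpleGraph.edgeSet_deleteEdges]
        rw [Nat.card_coe_set_eq, Nat.card_coe_set_eq]
        exact Set.ncard_sdiff_singleton_lt_of_mem (by simpa using huv)
      obtain ⟨P, hP1, hP2, -⟩ := ihm _ hcard V (G.deleteEdges {s(u, v)}) hV rfl
      obtain ⟨Q, hQ1, hQ2, hQ3⟩ := ihn _ {w : V // w ≠ u}
        (contractGraph G u ⟨v, huv.ne'⟩) (by
          rw [Fintype.card_subtype_compl]
          simp [hV]) rfl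
      have e : (-1 : ℚ) ^ (n + 1) * (P - Q).coeff 1 =
          (-1) ^ (n + 1) * P.coeff 1 + (-1) ^ n * Q.coeff 1 := by
        rw [Polynomial.coeff_sub]; ring
      refine ⟨P - Q, ?_, ?_, ?_⟩
      · intro q
        rw [Polynomial.eval_sub, hP1, hQ1,
          numColorings_delete G u ⟨v, huv.ne'⟩ huv]
        push_cast
        ring
      · rw [e]; exact add_nonneg hP2 hQ2
      · intro h
        rw [e]
        exact add_pos_of_nonneg_of_pos hP2 (hQ3 (contract_connected G u _ h))

/-! ### Products of elementary symmetric polynomials as chromatic symmetric polynomials -/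

theorem chromPoly_sum (C : Type) [Fintype C] {W W' : Type} [Fintype W] [Fintype W']
    (H : SimpleGraph W) (H' : SimpleGraph W') :
    chromPoly C (H ⊕g H') = chromPoly C H * chromPoly C H' := by
  unfold chromPoly
  rw [Finset.sum_mul_sum, ← Finset.sum_product', Finset.univ_product_univ]
  refine Finset.sum_equiv (Equiv.sumArrowEquivProdArrow W W' C) (by simp) fun κ _ => ?_
  have hiff : (∀ u v, (H ⊕g H').Adj u v → κ u ≠ κ v) ↔
      (∀ u v, H.Adj u v → κ (Sum.inl u) ≠ κ (Sum.inl v)) ∧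
      (∀ u v, H'.Adj u v → κ (Sum.inr u) ≠ κ (Sum.inr v)) := by
    simp [SimpleGraph.sum]
  rw [Fintype.prod_sum_type]
  split_ifs with h0 h1 h2 h3 h4 h5 h6
  · rfl
  · exact (h2 (hiff.1 h0).2).elim
  · exact (h1 (hiff.1 h0).1).elim
  · exact (h3 (hiff.1 h0).2).elim
  · exact (h0 (hiff.2 ⟨h4, h5⟩)).elim
  · rw [mul_zero]
  · rw [zero_mul]
  · rw [zero_mul]

theorem chromPoly_top (C : Type) [Fintype C] (U : Type) [Fintype U] (m : ℕ)
    (hU : Fintype.card U = m) (K : SimpleGraph U) (hK : ∀ u v, K.Adj u v ↔ u ≠ v) :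
    chromPoly C K = (m.factorial : ℚ) • MvPolynomial.esymm C ℚ m := by
  have h0 : chromPoly C K =
      ∑ κ ∈ Finset.univ.filter (fun κ : U → C => Function.Injective κ),
        ∏ v, MvPolynomial.X (κ v) := by
    unfold chromPoly
    rw [Finset.sum_filter]
    refine Finset.sum_congr rfl fun κ _ => if_congr ?_ rfl rfl
    simp only [hK]
    exact ⟨fun h a b hab => by_contra fun hne => h a b hne hab, fun h a b hne hab => hne (h hab)⟩
  rw [h0, MvPolynomial.esymm, Finset.smul_sum]
  have hmaps : ∀ κ ∈ Finset.univ.filter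
      (fun κ : U → C => Function.Injective κ),
      Finset.univ.image κ ∈ Finset.powersetCard m (Finset.univ : Finset C) := by
    intro κ hκ
    simp only [Finset.mem_filter, Finset.mem_univ, true_and] at hκ
    rw [Finset.mem_powersetCard_univ, Finset.card_image_of_injective _ hκ]
    exact hU
  rw [← Finset.sum_fiberwise_of_maps_to hmaps]
  refine Finset.sum_congr rfl fun s hs => ?_
  rw [Finset.mem_powersetCard_univ] at hs
  have hinj : ∀ κ : U → C, Finset.univ.image κ = s → Function.Injective κ := by
    intro κ h
    have : (Finset.univ.image κ).card = (Finset.univ : Finset (U)).card := by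
      rw [h, hs]; exact hU.symm
    simpa using Finset.card_image_iff.1 this
  have hconst : ∀ κ ∈ (Finset.univ.filter
      (fun κ : U → C => Function.Injective κ)).filter
        (fun κ => Finset.univ.image κ = s),
      (∏ v, MvPolynomial.X (κ v) : MvPolynomial C ℚ) = ∏ i ∈ s, MvPolynomial.X i := by
    intro κ hκ
    have h := (Finset.mem_filter.1 hκ).2
    conv_rhs => rw [← h]
    rw [Finset.prod_image]
    exact fun a _ b _ hab => hinj κ h hab
  rw [Finset.sum_congr rfl hconst, Finset.sum_const]
  have hcard : ((Finset.univ.filter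
      (fun κ : U → C => Function.Injective κ)).filter
        (fun κ => Finset.univ.image κ = s)).card = m.factorial := by
    have e0 : Fintype.card (U ≃ s) = m.factorial := by
      rw [Fintype.card_equiv (Fintype.equivOfCardEq (by simp [hs, hU])), hU]
    rw [← e0, ← Finset.card_univ]
    symm
    refine Finset.card_bij (fun e _ i => (e i : C)) ?_ ?_ ?_
    · intro e _
      simp only [Finset.mem_filter, Finset.mem_univ, true_and]
      refine ⟨fun a b h => e.injective (Subtype.ext h), ?_⟩
      ext x
      simp only [Finset.mem_image, Finset.mem_univ, true_and]
      constructor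
      · rintro ⟨a, rfl⟩; exact (e a).2
      · intro hx; exact ⟨e.symm ⟨x, hx⟩, by simp⟩
    · intro e _ e' _ h
      ext i
      exact congrFun h i
    · intro κ hκ
      have h := (Finset.mem_filter.1 hκ).2
      have hm : ∀ i, κ i ∈ s := fun i => by rw [← h]; simp
      refine ⟨Equiv.ofBijective (fun i => ⟨κ i, hm i⟩) ⟨?_, ?_⟩, Finset.mem_univ _, ?_⟩
      · intro a b hab
        exact hinj κ h (congrArg Subtype.val hab)
      · rintro ⟨x, hx⟩
        rw [← h] at hx
        obtain ⟨i, -, rfl⟩ := Finset.mem_image.1 hx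
        exact ⟨i, rfl⟩
      · rfl
  rw [hcard, Nat.cast_smul_eq_nsmul]

theorem exists_graph_of_multiset (s : Multiset ℕ) :
    ∃ (W : Type) (_ : Fintype W) (H : SimpleGraph W) (a : ℚ), 0 ≤ a ∧
      ∀ (C : Type) [Fintype C],
        (s.map (MvPolynomial.esymm C ℚ)).prod = a • chromPoly C H := by
  induction s using Multiset.induction_on with
  | empty =>
    refine ⟨Empty, inferInstance, ⊥, 1, zero_le_one, ?_⟩
    intro C _
    simp [chromPoly]
  | cons m s ih =>
    obtain ⟨W, _, H, a, ha, h⟩ := ih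
    refine ⟨Fin m ⊕ W, inferInstance, (⊤ : SimpleGraph (Fin m)) ⊕g H,
      (m.factorial : ℚ)⁻¹ * a, by positivity, ?_⟩
    intro C _
    rw [Multiset.map_cons, Multiset.prod_cons, h, chromPoly_sum, chromPoly_top C (Fin m) m (Fintype.card_fin m) _ (fun _ _ => SimpleGraph.top_adj _ _)]
    rw [smul_mul_assoc, mul_smul_comm, smul_smul]
    congr 1
    have : (m.factorial : ℚ) ≠ 0 := by positivity
    field_simp

/-! ### The matching functional -/

/-- The number of permutations preserving `g`. -/
noncomputable def stabNum {A C : Type} [Fintype A] (g : A → C) : ℕ :=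
  (Finset.univ.filter fun τ : Equiv.Perm A => ∀ s, g (τ s) = g s).card

theorem stab_mul_coeff {A C W : Type} [Fintype A] [Fintype C] [Fintype W] (g : A → C)
    (H : SimpleGraph W) :
    (stabNum g : ℚ) * MvPolynomial.coeff (∑ s, Finsupp.single (g s) 1) (chromPoly C H) =
      ((Finset.univ.filter fun σ : A ≃ W => ∀ s t, H.Adj (σ s) (σ t) → g s ≠ g t).card : ℚ) := by
  rw [coeff_chromPoly, Nat.card_eq_fintype_card, Fintype.card_subtype]
  norm_cast
  have hmaps : ∀ σ ∈ (Finset.univ.filter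
      fun σ : A ≃ W => ∀ s t, H.Adj (σ s) (σ t) → g s ≠ g t),
      (fun w => g (σ.symm w)) ∈ (Finset.univ.filter fun κ : W → C =>
        (∀ u v, H.Adj u v → κ u ≠ κ v) ∧ ∀ i, Nat.card {v : W // κ v = i} =
          (∑ s, Finsupp.single (g s) 1 : C →₀ ℕ) i) := by
    intro σ hσ
    simp only [Finset.mem_filter, Finset.mem_univ, true_and] at hσ ⊢
    refine ⟨fun u v huv => hσ _ _ (by simpa using huv), ?_⟩
    rw [← content_eq]
    exact Fintype.sum_equiv σ.symm _ _ (fun _ => rfl)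
  rw [Finset.card_eq_sum_card_fiberwise hmaps, mul_comm, ← smul_eq_mul, ← Finset.sum_const]
  refine Finset.sum_congr rfl fun κ hκ => ?_
  simp only [Finset.mem_filter, Finset.mem_univ, true_and] at hκ
  obtain ⟨h1, h2⟩ := hκ
  have h3 := (content_eq g _).1 rfl
  have hfib : ∀ c, Nonempty ({a // g a = c} ≃ {w // κ w = c}) := by
    intro c
    exact ⟨Fintype.equivOfCardEq (by
      rw [← Nat.card_eq_fintype_card, ← Nat.card_eq_fintype_card]
      exact (h3 c).trans (h2 c).symm)⟩
  let σ₀ : A ≃ W := Equiv.ofFiberEquiv fun c => (hfib c).some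
  have hσ₀ : ∀ a, κ (σ₀ a) = g a := fun a => Equiv.ofFiberEquiv_map _ a
  rw [stabNum]
  refine Finset.card_bij (fun τ _ => τ.trans σ₀) ?_ ?_ ?_
  · intro τ hτ
    simp only [Finset.mem_filter, Finset.mem_univ, true_and] at hτ ⊢
    refine ⟨?_, ?_⟩
    · intro s t hst
      have := h1 _ _ hst
      simpa [hσ₀, hτ] using this
    · funext w
      have e := hσ₀ (σ₀.symm w)
      have e' := hτ (τ.symm (σ₀.symm w))
      simp only [Equiv.apply_symm_apply] at e e'
      rw [e, e']
      rfl
  · intro τ _ τ' _ h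
    ext a
    have := congrArg (fun f : A ≃ W => σ₀.symm (f a)) h
    simpa using this
  · intro σ hσ
    simp only [Finset.mem_filter, Finset.mem_univ, true_and] at hσ
    refine ⟨σ.trans σ₀.symm, ?_, ?_⟩
    · simp only [Finset.mem_filter, Finset.mem_univ, true_and]
      intro s
      rw [← hσ₀, ← hσ.2]
      simp
    · ext a
      simp

/-- The slots: `k` pairs and `r` singletons. -/
abbrev Slots (k r : ℕ) : Type := (Fin k × Bool) ⊕ Fin r

/-- The map identifying the two members of each pair in `T`. -/
noncomputable def slotMap {k r : ℕ} (T : Finset (Fin k)) : Slots k r → Slots k r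
  | Sum.inl (i, b) => Sum.inl (i, if i ∈ T then false else b)
  | Sum.inr j => Sum.inr j

/-- The functional counting (almost) perfect matchings. -/
noncomputable def matchFun (k r : ℕ) (p : MvPolynomial (Slots k r) ℚ) : ℚ :=
  ∑ T : Finset (Fin k), (-1) ^ T.card * ((stabNum (slotMap (r := r) T) : ℚ) *
    MvPolynomial.coeff (∑ s, Finsupp.single (slotMap T s) 1) p)

theorem matchFun_smul (k r : ℕ) (a : ℚ) (p : MvPolynomial (Slots k r) ℚ) :
    matchFun k r (a • p) = a * matchFun k r p := by
  unfold matchFun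
  rw [Finset.mul_sum]
  refine Finset.sum_congr rfl fun T _ => ?_
  rw [MvPolynomial.coeff_smul, smul_eq_mul]
  ring

theorem matchFun_sum (k r : ℕ) {ι : Type} (s : Finset ι) (p : ι → MvPolynomial (Slots k r) ℚ) :
    matchFun k r (∑ i ∈ s, p i) = ∑ i ∈ s, matchFun k r (p i) := by
  unfold matchFun
  rw [Finset.sum_comm]
  refine Finset.sum_congr rfl fun T _ => ?_
  rw [MvPolynomial.coeff_sum, Finset.mul_sum, Finset.mul_sum]

theorem matchFun_chromPoly (k r : ℕ) {W : Type} [Fintype W] (H : SimpleGraph W) :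
    matchFun k r (chromPoly (Slots k r) H) =
      ((Finset.univ.filter fun σ : Slots k r ≃ W =>
        ∀ i, H.Adj (σ (Sum.inl (i, false))) (σ (Sum.inl (i, true)))).card : ℚ) := by
  unfold matchFun
  simp only [stab_mul_coeff]
  have hiff : ∀ (T : Finset (Fin k)) (σ : Slots k r ≃ W),
      (∀ s t, H.Adj (σ s) (σ t) → slotMap T s ≠ slotMap T t) ↔
        ∀ i ∈ T, ¬ H.Adj (σ (Sum.inl (i, false))) (σ (Sum.inl (i, true))) := by
    intro T σ
    constructor
    · intro h i hi hadj
      exact h _ _ hadj (by simp [slotMap, hi])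
    · intro h s t hadj heq
      rcases s with ⟨i, b⟩ | s <;> rcases t with ⟨j, b'⟩ | t
      · simp only [slotMap, Sum.inl.injEq, Prod.mk.injEq] at heq
        obtain ⟨rfl, h2⟩ := heq
        by_cases hi : i ∈ T
        · have := h i hi
          cases b <;> cases b'
          · exact hadj.ne rfl
          · exact this hadj
          · exact this hadj.symm
          · exact hadj.ne rfl
        · simp only [hi, if_false] at h2
          subst h2
          exact hadj.ne rfl
      · simp [slotMap] at heq
      · simp [slotMap] at heq
      · simp only [slotMap, Sum.inr.injEq] at heq
        subst heq
        exact hadj.ne rfl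
  have e1 : ∀ T : Finset (Fin k), ((-1 : ℚ) ^ T.card * ((Finset.univ.filter fun σ : Slots k r ≃ W =>
      ∀ s t, H.Adj (σ s) (σ t) → slotMap T s ≠ slotMap T t).card : ℚ)) =
      ∑ σ : Slots k r ≃ W, ∏ i ∈ T,
        (if H.Adj (σ (Sum.inl (i, false))) (σ (Sum.inl (i, true))) then (0 : ℚ) else -1) := by
    intro T
    rw [Finset.card_filter]
    push_cast
    rw [Finset.mul_sum]
    refine Finset.sum_congr rfl fun σ _ => ?_
    by_cases h : ∀ i ∈ T, ¬ H.Adj (σ (Sum.inl (i, false))) (σ (Sum.inl (i, true)))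
    · rw [if_pos ((hiff T σ).2 h), mul_one, Finset.prod_congr rfl fun i hi => if_neg (h i hi),
        Finset.prod_const]
    · rw [if_neg (fun h' => h ((hiff T σ).1 h')), mul_zero]
      push Not at h
      obtain ⟨i, hi, hadj⟩ := h
      symm
      apply Finset.prod_eq_zero hi
      rw [if_pos hadj]
  trans ∑ T : Finset (Fin k), ∑ σ : Slots k r ≃ W, ∏ i ∈ T,
        (if H.Adj (σ (Sum.inl (i, false))) (σ (Sum.inl (i, true))) then (0 : ℚ) else -1)
  · refine Finset.sum_congr rfl fun T _ => ?_
    convert e1 T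
  rw [Finset.sum_comm, Finset.card_filter]
  push_cast
  refine Finset.sum_congr rfl fun σ _ => ?_
  rw [← Finset.powerset_univ, ← Finset.prod_one_add]
  by_cases h : ∀ i, H.Adj (σ (Sum.inl (i, false))) (σ (Sum.inl (i, true)))
  · simp [h]
  · rw [if_neg h]
    push Not at h
    obtain ⟨i, hi⟩ := h
    refine Finset.prod_eq_zero (Finset.mem_univ i) ?_
    rw [if_neg hi]
    norm_num

theorem matchFun_parts_nonneg (k r : ℕ) (s : Multiset ℕ) :
    0 ≤ matchFun k r (s.map (MvPolynomial.esymm (Slots k r) ℚ)).prod := by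
  obtain ⟨W, _, H, a, ha, h⟩ := exists_graph_of_multiset s
  rw [h, matchFun_smul, matchFun_chromPoly]
  positivity

theorem matchFun_esymm_pos (k r : ℕ) :
    0 < matchFun k r (MvPolynomial.esymm (Slots k r) ℚ (2 * k + r)) := by
  have h := matchFun_chromPoly k r (⊤ : SimpleGraph (Fin (2 * k + r)))
  rw [chromPoly_top _ _ (2 * k + r) (Fintype.card_fin _) _
    (fun _ _ => SimpleGraph.top_adj _ _), matchFun_smul] at h
  have hpos : (0 : ℚ) < ((2 * k + r).factorial : ℚ) := by positivity
  refine pos_of_mul_pos_right ?_ hpos.le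
  rw [h, Nat.cast_pos, Finset.card_pos]
  refine ⟨Fintype.equivOfCardEq (by simp; ring), ?_⟩
  simp

/-! ### Independent sets and the final argument -/

theorem indep_le_of_matching {V : Type} [Fintype V] (G : SimpleGraph V) (k r : ℕ)
    (σ : Slots k r ≃ V)
    (h : ∀ i, G.Adj (σ (Sum.inl (i, false))) (σ (Sum.inl (i, true))))
    (S : Finset V) (hS : (S : Set V).Pairwise (fun u v => ¬ G.Adj u v)) :
    S.card ≤ k + r := by
  have e : Fintype.card (Fin k ⊕ Fin r) = k + r := by simp
  rw [← e, ← Finset.card_univ]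
  refine Finset.card_le_card_of_injOn
    (fun v => Sum.map Prod.fst id (σ.symm v)) (fun _ _ => Finset.mem_univ _) ?_
  intro u hu v hv huv
  by_contra hne
  have hadj := hS hu hv hne
  obtain ⟨a, rfl⟩ := σ.surjective u
  obtain ⟨b, rfl⟩ := σ.surjective v
  simp only [Equiv.symm_apply_apply] at huv
  rcases a with ⟨i, x⟩ | a <;> rcases b with ⟨j, y⟩ | b
  · simp only [Sum.map_inl, Sum.inl.injEq] at huv
    subst huv
    cases x <;> cases y
    · exact hne rfl
    · exact hadj (h i)
    · exact hadj (h i).symm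
    · exact hne rfl
  · simp at huv
  · simp at huv
  · simp only [Sum.map_inr, id, Sum.inr.injEq] at huv
    exact hne (by rw [huv])

theorem exists_indep {V : Type} [Fintype V] (G : SimpleGraph V) (h : 0 < independenceNumber G) :
    ∃ S : Finset V, (S : Set V).Pairwise (fun u v => ¬ G.Adj u v) ∧
      S.card = independenceNumber G := by
  unfold independenceNumber at *
  obtain ⟨S, -, hS⟩ := Finset.exists_mem_eq_sup (Finset.univ : Finset (Finset V))
    Finset.univ_nonempty (fun S : Finset V =>
      if (S : Set V).Pairwise (fun u v => ¬ G.Adj u v) then S.card else 0)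
  rw [hS] at h ⊢
  refine ⟨S, ?_⟩
  split_ifs at h ⊢ with h'
  · exact ⟨h', rfl⟩
  · exact absurd h (lt_irrefl 0)

/-- `binom(X, m)` as a polynomial. -/
noncomputable def binomPoly (m : ℕ) : Polynomial ℚ :=
  Polynomial.C ((m.factorial : ℚ)⁻¹) * descPochhammer ℚ m

theorem binomPoly_eval (m q : ℕ) : (binomPoly m).eval (q : ℚ) = (q.choose m : ℚ) := by
  rw [binomPoly, Polynomial.eval_mul, Polynomial.eval_C, descPochhammer_eval_eq_descFactorial,
    Nat.descFactorial_eq_factorial_mul_choose]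
  have : (m.factorial : ℚ) ≠ 0 := by positivity
  push_cast
  field_simp

theorem X_dvd_binomPoly (m : ℕ) (hm : 0 < m) : Polynomial.X ∣ binomPoly m := by
  obtain ⟨m, rfl⟩ := Nat.exists_eq_succ_of_ne_zero hm.ne'
  rw [binomPoly, descPochhammer_succ_left]
  exact Dvd.dvd.mul_left (dvd_mul_right _ _) _

theorem X_pow_dvd_parts (s : Multiset ℕ) (hs : ∀ m ∈ s, 0 < m) :
    Polynomial.X ^ s.card ∣ (s.map binomPoly).prod := by
  induction s using Multiset.induction_on with
  | empty => simp
  | cons a s ih =>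
    rw [Multiset.card_cons, pow_succ', Multiset.map_cons, Multiset.prod_cons]
    exact mul_dvd_mul (X_dvd_binomPoly a (hs a (Multiset.mem_cons_self a s)))
      (ih fun m hm => hs m (Multiset.mem_cons_of_mem hm))

theorem coeff_one_parts (s : Multiset ℕ) (hs : ∀ m ∈ s, 0 < m) (h2 : 2 ≤ s.card) :
    ((s.map binomPoly).prod).coeff 1 = 0 :=
  Polynomial.X_pow_dvd_iff.1 (X_pow_dvd_parts s hs) 1 (by omega)

theorem eval_one_chromPoly {V : Type} [Fintype V] (G : SimpleGraph V) (q : ℕ) :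
    MvPolynomial.eval (fun _ => (1 : ℚ)) (chromPoly (Fin q) G) = numColorings G q := by
  rw [chromPoly, numColorings, map_sum, Finset.card_filter]
  push_cast
  refine Finset.sum_congr rfl fun κ _ => ?_
  split_ifs <;> simp

theorem eval_one_esymm (q m : ℕ) :
    MvPolynomial.eval (fun _ => (1 : ℚ)) (MvPolynomial.esymm (Fin q) ℚ m) = (q.choose m : ℚ) := by
  rw [MvPolynomial.esymm, map_sum]
  simp

/-- A connected finite simple graph on `n` vertices whose independence number equals
`⌈n/2⌉ + 1` is not e-positive. -/
theorem not_ePositive_of_independenceNumber_eq {V : Type} [Fintype V] (G : SimpleGraph V)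
    (hconn : G.Connected)
    (hα : independenceNumber G = (Fintype.card V + 1) / 2 + 1) :
    ¬ EPositive G := by
  rintro ⟨c, hc, hX⟩
  have htr := trunc_expansion G c hX
  have hne : Nonempty V := hconn.nonempty
  have hcard : 0 < Fintype.card V := Fintype.card_pos
  -- no (almost) perfect matching
  obtain ⟨S, hS, hScard⟩ := exists_indep G (by omega)
  have hkr : 2 * (Fintype.card V / 2) + Fintype.card V % 2 = Fintype.card V := by omega
  have hzero : matchFun (Fintype.card V / 2) (Fintype.card V % 2)
      (chromPoly (Slots (Fintype.card V / 2) (Fintype.card V % 2)) G) = 0 := by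
    rw [matchFun_chromPoly, Nat.cast_eq_zero, Finset.card_eq_zero, Finset.filter_eq_empty_iff]
    intro σ _ hσ
    have := indep_le_of_matching G _ _ σ hσ S hS
    omega
  rw [htr, matchFun_sum] at hzero
  simp only [matchFun_smul] at hzero
  rw [Finset.sum_eq_zero_iff_of_nonneg
    (fun lam _ => mul_nonneg (hc lam) (matchFun_parts_nonneg _ _ _))] at hzero
  have hsingle : ∀ lam : (Fintype.card V).Partition, lam.parts.card ≤ 1 → c lam = 0 := by
    intro lam hlam
    have h0 := hzero lam (Finset.mem_univ _)
    have hparts : lam.parts = {Fintype.card V} := by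
      have hsum := lam.parts_sum
      have h1 : lam.parts.card = 1 := by
        rcases Nat.le_one_iff_eq_zero_or_eq_one.1 hlam with h | h
        · rw [Multiset.card_eq_zero] at h
          rw [h] at hsum
          simp at hsum
          omega
        · exact h
      obtain ⟨a, ha⟩ := Multiset.card_eq_one.1 h1
      rw [ha] at hsum ⊢
      simpa using hsum
    rw [hparts] at h0
    have hpos := matchFun_esymm_pos (Fintype.card V / 2) (Fintype.card V % 2)
    rw [hkr] at hpos
    rw [Multiset.map_singleton, Multiset.prod_singleton] at h0
    exact (mul_eq_zero.1 h0).resolve_right hpos.ne'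
  -- the chromatic polynomial
  obtain ⟨n, hn⟩ := Nat.exists_eq_succ_of_ne_zero hcard.ne'
  obtain ⟨P, hP, -, hPpos⟩ := chromaticPolynomial_exists n _ V G hn rfl
  have hPQ : P = ∑ lam : (Fintype.card V).Partition,
      Polynomial.C (c lam) * (lam.parts.map binomPoly).prod := by
    refine Polynomial.eq_of_infinite_eval_eq _ _ ?_
    refine Set.Infinite.mono ?_ (Set.infinite_range_of_injective (Nat.cast_injective (R := ℚ)))
    rintro _ ⟨q, rfl⟩
    change P.eval (q : ℚ) = Polynomial.eval (q : ℚ) _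
    rw [hP, ← eval_one_chromPoly, htr, map_sum, Polynomial.eval_finsetSum]
    refine Finset.sum_congr rfl fun lam _ => ?_
    rw [Polynomial.eval_mul, Polynomial.eval_C, MvPolynomial.smul_eval, map_multiset_prod,
      Polynomial.eval_multiset_prod, Multiset.map_map, Multiset.map_map]
    simp only [Function.comp_def, eval_one_esymm, binomPoly_eval]
  have hcoeff : P.coeff 1 = 0 := by
    rw [hPQ, Polynomial.finsetSum_coeff]
    refine Finset.sum_eq_zero fun lam _ => ?_
    rw [Polynomial.coeff_C_mul]
    by_cases h : lam.parts.card ≤ 1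
    · rw [hsingle lam h, zero_mul]
    · rw [coeff_one_parts _ (fun m hm => lam.parts_pos hm) (by omega), mul_zero]
  have := hPpos hconn
  rw [hcoeff, mul_zero] at this
  exact lt_irrefl _ this
end
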